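/- arXiv:2309.00273 — 2 statements merged into one kernel-verified Lean document; each statement's English description precedes it below -/
import Mathlib

section
/- In the abstract eigenvalue setting (V ↪ X compact, A_t, B_t symmetric bounded coercive, differentiable in t with derivatives Ȧ_t, Ḃ_t in the uniform sense), fix t with λ_{k−1}(t) < λ ≡ λ_k(t) = ⋯ = λ_{k+m−1}(t) < λ_{k+m}(t). Then for k ≤ j ≤ k+m−1 the one-sided derivatives λ̇_j^±(t) = lim_{h→±0} (λ_j(t+h) − λ_j(t))/h exist, and λ̇_j^+(t) equals the (j−k+1)-th eigenvalue μ_{j−k+1} of the finite-dimensional problem: find u ∈ Y (the m-dimensional eigenspace of λ) with E(u,v) = μ B_t(u,v) for all v ∈ Y, where E = Ȧ_t − λ Ḃ_t; moreover λ̇_j^−(t) = μ_{k+m−j}, so that λ̇_j^+(t) = λ̇_{2k+m−1−j}^−(t). -/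
/-- The `j`-th eigenvalue of the pair of forms `(A, B)` defined by the
Courant–Fischer min-max principle. -/
noncomputable def minMaxEig {V : Type*} [AddCommGroup V] [Module ℝ V]
    (A B : V → V → ℝ) (j : ℕ) : ℝ :=
  sInf {μ : ℝ | ∃ L : Submodule ℝ V, Module.finrank ℝ L = j ∧
    μ = sSup ((fun v => A v v / B v v) '' {v : V | v ∈ L ∧ v ≠ 0})}

section MinMax

open Filter Topology Module

variable {V : Type*} [NormedAddCommGroup V] [NormedSpace ℝ V]

theorem exists_coercive_of_pos (b : V →ₗ[ℝ] V →ₗ[ℝ] ℝ) (C : ℝ)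
    (hb : ∀ u v, |b u v| ≤ C * ‖u‖ * ‖v‖) (L : Submodule ℝ V) [FiniteDimensional ℝ L]
    (hpos : ∀ v ∈ L, v ≠ 0 → 0 < b v v) :
    ∃ c > 0, ∀ v ∈ L, c * ‖v‖ ^ 2 ≤ b v v := by
  let f : V →L[ℝ] V →L[ℝ] ℝ := b.mkContinuous₂ C hb
  have hcont : Continuous fun v : L => b v v := by
    have : Continuous fun v : L => f (v : V) (v : V) := by fun_prop
    exact this
  have hscale : ∀ c : ℝ, (∀ v : L, ‖v‖ = 1 → c ≤ b v v) → ∀ v ∈ L, c * ‖v‖ ^ 2 ≤ b v v := by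
    intro c hc v hv
    rcases eq_or_ne v 0 with rfl | h0
    · simp
    have hn : 0 < ‖v‖ := norm_pos_iff.2 h0
    have h1 := hc ⟨‖v‖⁻¹ • v, L.smul_mem _ hv⟩ (by
      simp [norm_smul, hn.ne'])
    simp only [map_smul, LinearMap.smul_apply, smul_eq_mul] at h1
    have h2 := mul_le_mul_of_nonneg_right h1 (sq_nonneg ‖v‖)
    have h3 : ‖v‖⁻¹ * (‖v‖⁻¹ * b v v) * ‖v‖ ^ 2 = b v v := by field_simp
    rwa [h3] at h2
  rcases (Metric.sphere (0 : L) 1).eq_empty_or_nonempty with he | hne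
  · refine ⟨1, one_pos, hscale 1 fun v hv => ?_⟩
    have : v ∈ Metric.sphere (0 : L) 1 := by simpa using hv
    simp [he] at this
  · obtain ⟨x, hx, hmin⟩ := (isCompact_sphere (0 : L) 1).exists_isMinOn hne hcont.continuousOn
    have hx1 : ‖x‖ = 1 := by simpa using hx
    refine ⟨b x x, hpos x x.2 fun h => ?_, hscale _ fun v hv => ?_⟩
    · have : x = 0 := Subtype.ext h
      simp [this] at hx1
    · exact hmin (show v ∈ Metric.sphere (0 : L) 1 by simpa using hv)

theorem exists_orthogonal_of_finrank_lt (Q : V →ₗ[ℝ] V →ₗ[ℝ] ℝ) (N L : Submodule ℝ V)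
    [FiniteDimensional ℝ N] (h : finrank ℝ N < finrank ℝ L) :
    ∃ u ∈ L, u ≠ 0 ∧ ∀ f ∈ N, Q f u = 0 := by
  have : FiniteDimensional ℝ L := .of_finrank_pos (by omega)
  have hk := LinearMap.ker_ne_bot_of_finrank_lt (f := Q.flip.domRestrict₁₂ L N) (by
    rw [Subspace.dual_finrank_eq]; exact h)
  obtain ⟨x, hx, hx0⟩ := Submodule.exists_mem_ne_zero_of_ne_bot hk
  refine ⟨x, x.2, fun h0 => hx0 (Subtype.ext h0), fun f hf => ?_⟩
  exact LinearMap.congr_fun (LinearMap.mem_ker.1 hx) ⟨f, hf⟩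

theorem exists_finrank_eq_of_le (L : Submodule ℝ V) (j : ℕ) (hj : j ≤ finrank ℝ L) :
    ∃ M : Submodule ℝ V, finrank ℝ M = j := by
  obtain ⟨f, hf⟩ := exists_linearIndependent_of_le_finrank hj
  exact ⟨_, (finrank_span_eq_card (hf.map' L.subtype L.ker_subtype)).trans (Fintype.card_fin j)⟩

variable {a b : V →ₗ[ℝ] V →ₗ[ℝ] ℝ}

theorem exists_finrank_eq_of_minMaxEig_pos {j : ℕ}
    (h : 0 < minMaxEig (fun u v => a u v) (fun u v => b u v) j) :
    ∃ L : Submodule ℝ V, finrank ℝ L = j := by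
  by_contra! hL
  refine h.ne' ?_
  unfold minMaxEig
  convert! Real.sInf_empty
  ext x
  simp only [Set.mem_ofPred_eq, Set.mem_empty_iff_false, iff_false]
  rintro ⟨L, hLj, -⟩
  exact hL L hLj

theorem rayleigh_sup_nonneg (ha : ∀ v, 0 ≤ a v v) (hb : ∀ v ≠ 0, 0 < b v v)
    (L : Submodule ℝ V) :
    0 ≤ sSup ((fun v => a v v / b v v) '' {v : V | v ∈ L ∧ v ≠ 0}) := by
  refine Real.sSup_nonneg ?_
  rintro _ ⟨v, ⟨-, hv⟩, rfl⟩
  exact div_nonneg (ha v) (hb v hv).le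

theorem minMaxEig_nonneg (ha : ∀ v, 0 ≤ a v v) (hb : ∀ v ≠ 0, 0 < b v v) (j : ℕ) :
    0 ≤ minMaxEig (fun u v => a u v) (fun u v => b u v) j := by
  refine Real.sInf_nonneg ?_
  rintro _ ⟨L, -, rfl⟩
  exact rayleigh_sup_nonneg ha hb L

theorem minMaxEig_le (ha : ∀ v, 0 ≤ a v v) (hb : ∀ v ≠ 0, 0 < b v v) {j : ℕ} (hj : 1 ≤ j)
    (L : Submodule ℝ V) (hL : finrank ℝ L = j) (c : ℝ) (hc : ∀ v ∈ L, a v v ≤ c * b v v) :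
    minMaxEig (fun u v => a u v) (fun u v => b u v) j ≤ c := by
  refine csInf_le_of_le (b := sSup ((fun v => a v v / b v v) '' {v : V | v ∈ L ∧ v ≠ 0}))
    ⟨0, ?_⟩ ⟨L, hL, rfl⟩ (csSup_le ?_ ?_)
  · rintro _ ⟨L, -, rfl⟩
    exact rayleigh_sup_nonneg ha hb L
  · have : Nontrivial L := nontrivial_of_finrank_pos (R := ℝ) (by omega)
    obtain ⟨x, hx⟩ := exists_ne (0 : L)
    exact ⟨_, x, ⟨x.2, fun h => hx (Subtype.ext h)⟩, rfl⟩
  · rintro _ ⟨v, ⟨hvL, hv⟩, rfl⟩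
    exact (div_le_iff₀ (hb v hv)).2 (hc v hvL)

theorem bddAbove_rayleigh {Ca Cb : ℝ} (hab : ∀ u v, |a u v| ≤ Ca * ‖u‖ * ‖v‖)
    (hbb : ∀ u v, |b u v| ≤ Cb * ‖u‖ * ‖v‖) (hb : ∀ v ≠ 0, 0 < b v v)
    (L : Submodule ℝ V) [FiniteDimensional ℝ L] :
    BddAbove ((fun v => a v v / b v v) '' {v : V | v ∈ L ∧ v ≠ 0}) := by
  obtain ⟨c, hc, hcL⟩ := exists_coercive_of_pos b Cb hbb L fun v _ hv => hb v hv
  refine ⟨|Ca| / c, ?_⟩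
  rintro _ ⟨v, ⟨hvL, hv⟩, rfl⟩
  have h1 : a v v ≤ |Ca| * ‖v‖ ^ 2 := by
    have := mul_le_mul_of_nonneg_right (le_abs_self Ca) (sq_nonneg ‖v‖)
    nlinarith [le_abs_self (a v v), hab v v]
  have h2 := mul_le_mul_of_nonneg_left (hcL v hvL) (div_nonneg (abs_nonneg Ca) hc.le)
  have h3 : |Ca| / c * (c * ‖v‖ ^ 2) = |Ca| * ‖v‖ ^ 2 := by field_simp
  exact (div_le_iff₀ (hb v hv)).2 (by linarith)

theorem le_minMaxEig {Ca Cb : ℝ} (hab : ∀ u v, |a u v| ≤ Ca * ‖u‖ * ‖v‖)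
    (hbb : ∀ u v, |b u v| ≤ Cb * ‖u‖ * ‖v‖) (hb : ∀ v ≠ 0, 0 < b v v) {j : ℕ} (hj : 1 ≤ j)
    (hex : ∃ L : Submodule ℝ V, finrank ℝ L = j) (c : ℝ)
    (hc : ∀ L : Submodule ℝ V, finrank ℝ L = j → ∃ u ∈ L, u ≠ 0 ∧ c * b u u ≤ a u u) :
    c ≤ minMaxEig (fun u v => a u v) (fun u v => b u v) j := by
  obtain ⟨L₀, hL₀⟩ := hex
  refine le_csInf ⟨_, L₀, hL₀, rfl⟩ ?_
  rintro _ ⟨L, hL, rfl⟩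
  have : FiniteDimensional ℝ L := .of_finrank_pos (by omega)
  obtain ⟨u, huL, hu, h⟩ := hc L hL
  exact ((le_div_iff₀ (hb u hu)).2 h).trans
    (le_csSup (bddAbove_rayleigh hab hbb hb L) ⟨u, ⟨huL, hu⟩, rfl⟩)

theorem exists_lt_of_minMaxEig_lt {Ca Cb : ℝ} (hab : ∀ u v, |a u v| ≤ Ca * ‖u‖ * ‖v‖)
    (hbb : ∀ u v, |b u v| ≤ Cb * ‖u‖ * ‖v‖) (hb : ∀ v ≠ 0, 0 < b v v) {j : ℕ} (hj : 1 ≤ j)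
    (hex : ∃ L : Submodule ℝ V, finrank ℝ L = j) {c : ℝ}
    (hc : minMaxEig (fun u v => a u v) (fun u v => b u v) j < c) :
    ∃ L : Submodule ℝ V, finrank ℝ L = j ∧ ∀ v ∈ L, v ≠ 0 → a v v < c * b v v := by
  obtain ⟨L₀, hL₀⟩ := hex
  obtain ⟨_, ⟨L, hL, rfl⟩, hlt⟩ := exists_lt_of_csInf_lt (by exact ⟨_, L₀, hL₀, rfl⟩) hc
  have : FiniteDimensional ℝ L := .of_finrank_pos (by omega)
  refine ⟨L, hL, fun v hvL hv => (div_lt_iff₀ (hb v hv)).1 (lt_of_le_of_lt ?_ hlt)⟩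
  exact le_csSup (bddAbove_rayleigh hab hbb hb L) ⟨v, ⟨hvL, hv⟩, rfl⟩

/-- A vector orthogonal to an `n`-dimensional subspace on which `a - c b` is nonpositive satisfies
`c b ≤ a` as soon as `c` lies below the `(n + 1)`-st min-max value. -/
theorem le_of_orthogonal_of_lt_minMaxEig (ha : ∀ v, 0 ≤ a v v) (hb : ∀ v ≠ 0, 0 < b v v)
    (has : ∀ u v, a u v = a v u) (hbs : ∀ u v, b u v = b v u)
    (F : Submodule ℝ V) [FiniteDimensional ℝ F] (c : ℝ)
    (hF : ∀ f ∈ F, a f f ≤ c * b f f)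
    (hc : c < minMaxEig (fun u v => a u v) (fun u v => b u v) (finrank ℝ F + 1))
    (z : V) (hz : ∀ f ∈ F, a f z = c * b f z) : c * b z z ≤ a z z := by
  by_contra! hneg
  have hzF : z ∉ F := fun h => hneg.ne (hz z h)
  have hz0 : z ≠ 0 := fun h => hzF (h ▸ F.zero_mem)
  refine hc.not_ge (minMaxEig_le ha hb (by omega) (F ⊔ Submodule.span ℝ {z}) ?_ c ?_)
  · have hdis : F ⊓ Submodule.span ℝ {z} = ⊥ :=
      ((Submodule.disjoint_span_singleton' hz0).2 hzF).eq_bot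
    have := Submodule.finrank_sup_add_finrank_inf_eq F (Submodule.span ℝ {z})
    rwa [hdis, finrank_bot, add_zero, finrank_span_singleton hz0] at this
  · intro v hv
    obtain ⟨f, hf, y, hy, rfl⟩ := Submodule.mem_sup.1 hv
    obtain ⟨r, rfl⟩ := Submodule.mem_span_singleton.1 hy
    simp only [map_add, map_smul, LinearMap.add_apply, LinearMap.smul_apply, smul_eq_mul,
      has z f, hbs z f, hz f hf]
    nlinarith [hF f hf, mul_nonneg (sq_nonneg r) (sub_nonneg.2 hneg.le)]

set_option maxHeartbeats 800000 in
/-- First-order lower estimate for the form `a h - (lam + h (mu - ε)) b h` on a sum `y + z`, where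
`y` is an eigenvector of the unperturbed pencil and `a 0 - lam b 0` is coercive at `z`. -/
theorem eventually_le_of_perturbation (a b : ℝ → V →ₗ[ℝ] V →ₗ[ℝ] ℝ) (a' b' : V →ₗ[ℝ] V →ₗ[ℝ] ℝ)
    (has : ∀ u v, a 0 u v = a 0 v u) (hbs : ∀ u v, b 0 u v = b 0 v u) (M : ℝ) (hM : 0 ≤ M)
    (hbM : ∀ u v, |b 0 u v| ≤ M * ‖u‖ * ‖v‖) (hb'M : ∀ u v, |b' u v| ≤ M * ‖u‖ * ‖v‖)
    (lam mu : ℝ) (hEM : ∀ u v, |a' u v - lam * b' u v| ≤ M * ‖u‖ * ‖v‖)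
    (hader : ∀ ρ > 0, ∀ᶠ h in 𝓝[>] (0 : ℝ), ∀ u,
      |a h u u - a 0 u u - h * a' u u| ≤ ρ * h * ‖u‖ ^ 2)
    (hbder : ∀ ρ > 0, ∀ᶠ h in 𝓝[>] (0 : ℝ), ∀ u,
      |b h u u - b 0 u u - h * b' u u| ≤ ρ * h * ‖u‖ ^ 2)
    (g c ε : ℝ) (hg : 0 < g) (hc : 0 < c) (hε : 0 < ε) :
    ∀ᶠ h in 𝓝[>] (0 : ℝ), ∀ y z : V,
      (∀ v, a 0 y v = lam * b 0 y v) → b 0 y z = 0 → c * ‖y‖ ^ 2 ≤ b 0 y y →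
      g * ‖z‖ ^ 2 ≤ a 0 z z - lam * b 0 z z →
      mu * b 0 y y ≤ a' y y - lam * b' y y →
      (lam + h * (mu - ε)) * b h (y + z) (y + z) ≤ a h (y + z) (y + z) := by
  obtain ⟨κ, hκ⟩ : ∃ κ, κ = mu - ε := ⟨_, rfl⟩
  obtain ⟨D, hD⟩ : ∃ D, D = ε * c := ⟨_, rfl⟩
  rw [← hκ]
  have hDpos : 0 < D := hD ▸ mul_pos hε hc
  have hl : 0 < 2 + |lam| := by positivity
  obtain ⟨ρ, hρ⟩ : ∃ ρ, ρ = D / (8 * (2 + |lam|)) := ⟨_, rfl⟩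
  have hρpos : 0 < ρ := by rw [hρ]; positivity
  have hρeq : ρ * (2 + |lam|) = D / 8 := by rw [hρ]; field_simp
  have small : ∀ K r : ℝ, 0 < r → ∀ᶠ h in 𝓝[>] (0 : ℝ), h * K < r := by
    intro K r hr
    have : Tendsto (fun h : ℝ => h * K) (𝓝[>] 0) (𝓝 0) := by
      have : Tendsto (fun h : ℝ => h * K) (𝓝 0) (𝓝 (0 * K)) :=
        (continuous_id.mul continuous_const).tendsto 0
      rw [zero_mul] at this
      exact this.mono_left nhdsWithin_le_nhds
    exact this.eventually_lt_const hr
  filter_upwards [hader ρ hρpos, hbder ρ hρpos, self_mem_nhdsWithin, small 1 1 one_pos,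
    small |κ| 1 one_pos, small (2 * M ^ 2 / g + 2 * |κ| * M) (D / 2) (by positivity),
    small (M + |κ| * M + D / 4 + 2 * |κ| * M) (g / 2) (by positivity)]
    with h ha hb hpos h1 hκ1 hy_small hz_small y z hy hyz hcy hgz hmu
  have hpos : 0 < h := hpos
  have hazy : a 0 y z = 0 := by rw [hy, hyz, mul_zero]
  obtain ⟨u, hu⟩ : ∃ u, u = y + z := ⟨_, rfl⟩
  rw [← hu]
  have e1 : a 0 u u - lam * b 0 u u = a 0 z z - lam * b 0 z z := by
    simp only [hu, map_add, LinearMap.add_apply, has z y, hbs z y, hazy, hyz, hy y]; ring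
  have e2 : b 0 u u = b 0 y y + b 0 z z := by
    simp only [hu, map_add, LinearMap.add_apply, hbs z y, hyz]; ring
  have e3 : a' u u - lam * b' u u = (a' y y - lam * b' y y) + (a' y z - lam * b' y z)
      + (a' z y - lam * b' z y) + (a' z z - lam * b' z z) := by
    simp only [hu, map_add, LinearMap.add_apply]; ring
  have hun : ‖u‖ ^ 2 ≤ 2 * ‖y‖ ^ 2 + 2 * ‖z‖ ^ 2 := by
    have := norm_add_le y z
    rw [← hu] at this
    nlinarith [sq_nonneg (‖y‖ - ‖z‖), norm_nonneg u, norm_nonneg y, norm_nonneg z]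
  have ra := (abs_le.1 (ha u)).1
  have rb : |(lam + h * κ) * (b h u u - b 0 u u - h * b' u u)|
      ≤ (|lam| + 1) * (ρ * h * ‖u‖ ^ 2) := by
    rw [abs_mul]
    refine mul_le_mul ((abs_add_le _ _).trans ?_) (hb u) (abs_nonneg _) (by positivity)
    rw [abs_mul, abs_of_pos hpos]
    linarith
  have rb' : |h ^ 2 * κ * b' u u| ≤ h ^ 2 * |κ| * (M * ‖u‖ * ‖u‖) := by
    rw [abs_mul, abs_mul, abs_of_nonneg (sq_nonneg h)]
    exact mul_le_mul_of_nonneg_left (hb'M u u) (by positivity)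
  have rbz : |h * κ * b 0 z z| ≤ h * |κ| * (M * ‖z‖ * ‖z‖) := by
    rw [abs_mul, abs_mul, abs_of_pos hpos]
    exact mul_le_mul_of_nonneg_left (hbM z z) (by positivity)
  have E1 := mul_le_mul_of_nonneg_left (abs_le.1 (hEM y z)).1 hpos.le
  have E2 := mul_le_mul_of_nonneg_left (abs_le.1 (hEM z y)).1 hpos.le
  have E3 := mul_le_mul_of_nonneg_left (abs_le.1 (hEM z z)).1 hpos.le
  have E4 := mul_le_mul_of_nonneg_left hmu hpos.le
  have E5 : h * D * ‖y‖ ^ 2 ≤ h * ε * b 0 y y := by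
    have := mul_le_mul_of_nonneg_left hcy (mul_pos hpos hε).le
    rw [hD]; linarith
  have young : 2 * h * M * ‖y‖ * ‖z‖ ≤ g / 2 * ‖z‖ ^ 2 + 2 * h ^ 2 * M ^ 2 / g * ‖y‖ ^ 2 := by
    have : g / 2 * ‖z‖ ^ 2 + 2 * h ^ 2 * M ^ 2 / g * ‖y‖ ^ 2 - 2 * h * M * ‖y‖ * ‖z‖
        = (g * ‖z‖ - 2 * h * M * ‖y‖) ^ 2 / (2 * g) := by field_simp; ring
    have : 0 ≤ (g * ‖z‖ - 2 * h * M * ‖y‖) ^ 2 / (2 * g) := by positivity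
    linarith
  have expand : a h u u - (lam + h * κ) * b h u u
      = (a 0 u u - lam * b 0 u u) + h * (a' u u - lam * b' u u) - h * κ * b 0 u u
        + (a h u u - a 0 u u - h * a' u u)
        - (lam + h * κ) * (b h u u - b 0 u u - h * b' u u) - h ^ 2 * κ * b' u u := by ring
  have Ru : ρ * h * ‖u‖ ^ 2 + (|lam| + 1) * (ρ * h * ‖u‖ ^ 2) + h ^ 2 * |κ| * (M * ‖u‖ * ‖u‖)
      ≤ (h * (D / 4) + 2 * h ^ 2 * |κ| * M) * (‖y‖ ^ 2 + ‖z‖ ^ 2) := by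
    have q1 : ρ * h * ‖u‖ ^ 2 + (|lam| + 1) * (ρ * h * ‖u‖ ^ 2)
        + h ^ 2 * |κ| * (M * ‖u‖ * ‖u‖) = (h * (ρ * (2 + |lam|)) + h ^ 2 * |κ| * M) * ‖u‖ ^ 2 := by
      ring
    rw [q1, hρeq]
    have := mul_le_mul_of_nonneg_left hun
      (show 0 ≤ h * (D / 8) + h ^ 2 * |κ| * M by positivity)
    linarith
  have Y := mul_le_mul_of_nonneg_right (mul_le_mul_of_nonneg_left hy_small.le hpos.le)
    (sq_nonneg ‖y‖)
  have Z := mul_le_mul_of_nonneg_right hz_small.le (sq_nonneg ‖z‖)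
  have Z2 : 2 * h ^ 2 * |κ| * M * ‖z‖ ^ 2 ≤ 2 * h * |κ| * M * ‖z‖ ^ 2 := by
    have : h ^ 2 ≤ h := by nlinarith
    have := mul_le_mul_of_nonneg_right this (show 0 ≤ 2 * |κ| * M * ‖z‖ ^ 2 by positivity)
    linarith
  have Dy : 0 ≤ h * D * ‖y‖ ^ 2 := by positivity
  have Y' : h * (h * (2 * M ^ 2 / g + 2 * |κ| * M)) * ‖y‖ ^ 2
      = 2 * h ^ 2 * M ^ 2 / g * ‖y‖ ^ 2 + 2 * h ^ 2 * |κ| * M * ‖y‖ ^ 2 := by ring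
  have rb1 := (abs_le.1 rb).2
  have rb'1 := (abs_le.1 rb').2
  have rbz1 := (abs_le.1 rbz).2
  have hκy : h * κ * b 0 u u = h * (mu * b 0 y y) - h * ε * b 0 y y + h * κ * b 0 z z := by
    rw [e2, hκ]; ring
  rw [← sub_nonneg, expand, e1, hκy, e3]
  linarith

section Orthonormal

variable {m : ℕ} {psi : Fin m → V}

theorem linearIndependent_of_orthonormal_form
    (horth : ∀ i j, b (psi i) (psi j) = if i = j then 1 else 0) : LinearIndependent ℝ psi := by
  rw [Fintype.linearIndependent_iff]
  intro c hc i
  have h := congrArg (b (psi i)) hc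
  simpa [map_sum, horth] using h

theorem eq_sum_of_mem_of_orthonormal_form {Y : Submodule ℝ V} (hm : 1 ≤ m)
    (hYdim : finrank ℝ Y = m) (hmem : ∀ i, psi i ∈ Y)
    (horth : ∀ i j, b (psi i) (psi j) = if i = j then 1 else 0) {y : V} (hy : y ∈ Y) :
    y = ∑ i, b (psi i) y • psi i := by
  have : FiniteDimensional ℝ Y := .of_finrank_pos (by omega)
  have hspan : Submodule.span ℝ (Set.range psi) = Y := by
    refine Submodule.eq_of_le_of_finrank_eq (Submodule.span_le.2 ?_) ?_
    · rintro _ ⟨i, rfl⟩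
      exact hmem i
    · rw [finrank_span_eq_card (linearIndependent_of_orthonormal_form horth), Fintype.card_fin,
        hYdim]
  rw [← hspan] at hy
  obtain ⟨c, rfl⟩ := (Submodule.mem_span_range_iff_exists_fun ℝ).1 hy
  simp [map_sum, horth]

/-- The span of the first `p` vectors of the family `psi`. -/
def initialSpan (psi : Fin m → V) (p : ℕ) (hp : p ≤ m) : Submodule ℝ V :=
  Submodule.span ℝ (Set.range fun i : Fin p => psi (Fin.castLE hp i))

theorem finrank_initialSpan (horth : ∀ i j, b (psi i) (psi j) = if i = j then 1 else 0)
    (p : ℕ) (hp : p ≤ m) : finrank ℝ (initialSpan psi p hp) = p := by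
  have h := (linearIndependent_of_orthonormal_form horth).comp _ (Fin.castLE_injective hp)
  exact (finrank_span_eq_card h).trans (Fintype.card_fin p)

theorem initialSpan_le {Y : Submodule ℝ V} (hmem : ∀ i, psi i ∈ Y) (p : ℕ) (hp : p ≤ m) :
    initialSpan psi p hp ≤ Y := by
  refine Submodule.span_le.2 ?_
  rintro _ ⟨i, rfl⟩
  exact hmem _

theorem mem_initialSpan {p : ℕ} {hp : p ≤ m} (i : Fin m) (hi : (i : ℕ) < p) :
    psi i ∈ initialSpan psi p hp :=
  Submodule.subset_span ⟨⟨i, hi⟩, rfl⟩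

theorem form_eq_zero_of_mem_initialSpan
    (horth : ∀ i j, b (psi i) (psi j) = if i = j then 1 else 0) {p : ℕ} {hp : p ≤ m} {y : V}
    (hy : y ∈ initialSpan psi p hp) (j : Fin m) (hj : p ≤ j) : b (psi j) y = 0 := by
  have : initialSpan psi p hp ≤ LinearMap.ker (b (psi j)) := by
    refine Submodule.span_le.2 ?_
    rintro _ ⟨i, rfl⟩
    have hne : j ≠ Fin.castLE hp i := by
      rintro rfl
      simp only [Fin.val_castLE] at hj
      omega
    simp [horth, hne]
  exact this hy

instance (p : ℕ) (hp : p ≤ m) : FiniteDimensional ℝ (initialSpan psi p hp) :=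
  FiniteDimensional.span_of_finite ℝ (Set.finite_range _)

/-- Both forms of a pencil are diagonal in a basis of eigenvectors. -/
theorem pencil_apply_self {Y : Submodule ℝ V} (hm : 1 ≤ m)
    (hYdim : finrank ℝ Y = m) (hmem : ∀ i, psi i ∈ Y)
    (horth : ∀ i j, b (psi i) (psi j) = if i = j then 1 else 0)
    {E : V →ₗ[ℝ] V →ₗ[ℝ] ℝ} {mu : Fin m → ℝ}
    (heig : ∀ i, ∀ v ∈ Y, E (psi i) v = mu i * b (psi i) v) {y : V} (hy : y ∈ Y) :
    E y y = ∑ i, mu i * b (psi i) y ^ 2 ∧ b y y = ∑ i, b (psi i) y ^ 2 := by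
  have key : ∀ Q : V →ₗ[ℝ] V →ₗ[ℝ] ℝ, Q y y = ∑ i, b (psi i) y * Q (psi i) y := by
    intro Q
    have h := congrArg (fun x => Q x y) (eq_sum_of_mem_of_orthonormal_form hm hYdim hmem horth hy)
    simpa [map_sum] using h
  constructor
  · rw [key E]
    refine Finset.sum_congr rfl fun i _ => ?_
    rw [heig i y hy]; ring
  · rw [key b]
    exact Finset.sum_congr rfl fun i _ => by ring

/-- A subspace of dimension `k - 1`, orthogonal to the eigenspace `Y`, on which `a - lam b` is
negative definite. -/
theorem exists_negative_subspace {Ca Cb : ℝ} (hab : ∀ u v, |a u v| ≤ Ca * ‖u‖ * ‖v‖)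
    (hbb : ∀ u v, |b u v| ≤ Cb * ‖u‖ * ‖v‖) (hb : ∀ v ≠ 0, 0 < b v v)
    (has : ∀ u v, a u v = a v u) (hbs : ∀ u v, b u v = b v u)
    {Y : Submodule ℝ V} (hm : 1 ≤ m) (hYdim : finrank ℝ Y = m) (hmem : ∀ i, psi i ∈ Y)
    (horth : ∀ i j, b (psi i) (psi j) = if i = j then 1 else 0)
    (lam : ℝ) (hY : ∀ y ∈ Y, ∀ v, a y v = lam * b y v) (n : ℕ)
    (hex : ∃ L : Submodule ℝ V, finrank ℝ L = n)
    (hlow : 1 ≤ n → minMaxEig (fun u v => a u v) (fun u v => b u v) n < lam) :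
    ∃ W : Submodule ℝ V, FiniteDimensional ℝ W ∧ finrank ℝ W = n ∧
      (∀ y ∈ Y, ∀ w ∈ W, b y w = 0) ∧
      ∃ g > 0, ∀ w ∈ W, g * ‖w‖ ^ 2 ≤ lam * b w w - a w w := by
  rcases Nat.eq_zero_or_pos n with rfl | hn
  · refine ⟨⊥, inferInstance, finrank_bot ℝ V, ?_, 1, one_pos, ?_⟩ <;> simp
  obtain ⟨L, hLn, hL⟩ := exists_lt_of_minMaxEig_lt hab hbb hb hn hex (hlow hn)
  have : FiniteDimensional ℝ L := .of_finrank_pos (by omega)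
  let P : V →ₗ[ℝ] V := ∑ i, (b (psi i)).smulRight (psi i)
  have hP : ∀ v, P v = ∑ i, b (psi i) v • psi i := fun v => by simp [P]
  have hPY : ∀ v, P v ∈ Y := fun v => by
    rw [hP]; exact Y.sum_mem fun i _ => Y.smul_mem _ (hmem i)
  let f : L →ₗ[ℝ] V := (LinearMap.id - P).domRestrict L
  have hf : ∀ v, f v = v - P v := fun v => rfl
  have hinj : Function.Injective f := by
    rw [injective_iff_map_eq_zero]
    intro v hv
    by_contra h0
    have hvY : (v : V) ∈ Y := by
      rw [hf, sub_eq_zero] at hv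
      rw [hv]; exact hPY v
    exact (hL v v.2 fun h => h0 (Subtype.ext h)).ne (hY v hvY v)
  have hneg : ∀ w ∈ LinearMap.range f, w ≠ 0 → 0 < (lam • b - a) w w := by
    rintro _ ⟨v, rfl⟩ h0
    have hv0 : (v : V) ≠ 0 := fun h => h0 (by rw [show v = 0 from Subtype.ext h, map_zero])
    have h1 := hL v v.2 hv0
    have h2 := hY _ (hPY v)
    simp only [hf, LinearMap.sub_apply, LinearMap.smul_apply, smul_eq_mul, map_sub,
      has (v : V) (P v), hbs (v : V) (P v), h2]
    linarith
  obtain ⟨g, hg, hgW⟩ := exists_coercive_of_pos (lam • b - a) (|lam| * Cb + Ca) (by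
    intro u v
    simp only [LinearMap.sub_apply, LinearMap.smul_apply, smul_eq_mul]
    refine (abs_sub _ _).trans ?_
    rw [abs_mul]
    have := mul_le_mul_of_nonneg_left (hbb u v) (abs_nonneg lam)
    linarith [hab u v]) (LinearMap.range f) hneg
  refine ⟨LinearMap.range f, inferInstance, ?_, ?_, g, hg, fun w hw => by simpa using hgW w hw⟩
  · rw [LinearMap.finrank_range_of_inj hinj, hLn]
  · rintro y hy _ ⟨v, rfl⟩
    rw [eq_sum_of_mem_of_orthonormal_form hm hYdim hmem horth hy, hf, hP]
    simp [map_sum, horth]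

end Orthonormal

theorem finrank_sup_of_form_orthogonal (hb : ∀ v ≠ 0, 0 < b v v) (W S : Submodule ℝ V)
    [FiniteDimensional ℝ W] [FiniteDimensional ℝ S] (h : ∀ y ∈ S, ∀ w ∈ W, b y w = 0) :
    finrank ℝ (W ⊔ S : Submodule ℝ V) = finrank ℝ W + finrank ℝ S := by
  have hinf : W ⊓ S = ⊥ := by
    refine (Submodule.eq_bot_iff _).2 fun v hv => ?_
    by_contra h0
    exact (hb v h0).ne' (h v hv.2 v hv.1)
  have := Submodule.finrank_sup_add_finrank_inf_eq W S
  rwa [hinf, finrank_bot, add_zero] at this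

set_option maxHeartbeats 800000 in
/-- The right derivative at `0` of the min-max values of a differentiable family of pencils
in a cluster of multiplicity `m`. -/
theorem tendsto_minMaxEig_right (a b : ℝ → V →ₗ[ℝ] V →ₗ[ℝ] ℝ) (a' b' : V →ₗ[ℝ] V →ₗ[ℝ] ℝ)
    (has : ∀ u v, a 0 u v = a 0 v u) (hbs : ∀ u v, b 0 u v = b 0 v u)
    (Ca Cb M δ : ℝ) (hδ : 0 < δ) (hM : 0 ≤ M)
    (hab : ∀ h u v, |a h u v| ≤ Ca * ‖u‖ * ‖v‖) (hbb : ∀ h u v, |b h u v| ≤ Cb * ‖u‖ * ‖v‖)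
    (hac : ∀ h v, δ * ‖v‖ ^ 2 ≤ a h v v) (hb : ∀ h, ∀ v ≠ 0, 0 < b h v v)
    (hbM : ∀ u v, |b 0 u v| ≤ M * ‖u‖ * ‖v‖) (hb'M : ∀ u v, |b' u v| ≤ M * ‖u‖ * ‖v‖)
    (lam : ℝ) (hEM : ∀ u v, |a' u v - lam * b' u v| ≤ M * ‖u‖ * ‖v‖)
    (hader : ∀ ρ > 0, ∀ᶠ h in 𝓝[>] (0 : ℝ), ∀ u,
      |a h u u - a 0 u u - h * a' u u| ≤ ρ * h * ‖u‖ ^ 2)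
    (hbder : ∀ ρ > 0, ∀ᶠ h in 𝓝[>] (0 : ℝ), ∀ u,
      |b h u u - b 0 u u - h * b' u u| ≤ ρ * h * ‖u‖ ^ 2)
    (k m : ℕ) (hk : 1 ≤ k) (hm : 1 ≤ m)
    (hlow : 2 ≤ k → minMaxEig (fun u v => a 0 u v) (fun u v => b 0 u v) (k - 1) < lam)
    (hlam : 0 ≤ lam)
    (hhigh : lam < minMaxEig (fun u v => a 0 u v) (fun u v => b 0 u v) (k + m))
    (Y : Submodule ℝ V) (hYdim : finrank ℝ Y = m)
    (hY : ∀ y ∈ Y, ∀ v, a 0 y v = lam * b 0 y v)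
    (mu : Fin m → ℝ) (hmu : Monotone mu) (psi : Fin m → V) (hmem : ∀ i, psi i ∈ Y)
    (horth : ∀ i j, b 0 (psi i) (psi j) = if i = j then 1 else 0)
    (heig : ∀ i, ∀ v ∈ Y, a' (psi i) v - lam * b' (psi i) v = mu i * b 0 (psi i) v)
    (q : Fin m) :
    Tendsto (fun h => (minMaxEig (fun u v => a h u v) (fun u v => b h u v) (k + q) - lam) / h)
      (𝓝[>] 0) (𝓝 (mu q)) := by
  have ha0 : ∀ h v, 0 ≤ a h v v := fun h v => (by positivity : 0 ≤ δ * ‖v‖ ^ 2).trans (hac h v)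
  have : FiniteDimensional ℝ Y := .of_finrank_pos (by omega)
  have hex : ∀ j ≤ k + m, ∃ L : Submodule ℝ V, finrank ℝ L = j := by
    obtain ⟨L, hL⟩ := exists_finrank_eq_of_minMaxEig_pos (hlam.trans_lt hhigh)
    exact fun j hj => exists_finrank_eq_of_le L j (by omega)
  obtain ⟨c, hc, hcY⟩ := exists_coercive_of_pos (b 0) Cb (hbb 0) Y fun v _ => hb 0 v
  obtain ⟨W, hWfin, hWdim, hYW, g, hg, hgW⟩ := exists_negative_subspace (hab 0) (hbb 0) (hb 0)
    has hbs hm hYdim hmem horth lam hY (k - 1) (hex _ (by omega)) fun h => hlow (by omega)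
  have hEself : ∀ y ∈ Y, a' y y - lam * b' y y = ∑ i, mu i * b 0 (psi i) y ^ 2 ∧
      b 0 y y = ∑ i, b 0 (psi i) y ^ 2 := by
    intro y hy
    simpa using pencil_apply_self (E := a' - lam • b') hm hYdim hmem horth
      (by simpa using heig) hy
  have hdim : ∀ p (hp : p ≤ m),
      finrank ℝ (W ⊔ initialSpan psi p hp : Submodule ℝ V) = k - 1 + p := by
    intro p hp
    rw [finrank_sup_of_form_orthogonal (hb 0) W (initialSpan psi p hp)
      fun y hy => hYW y (initialSpan_le hmem p hp hy), hWdim, finrank_initialSpan horth]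
  have upper : ∀ ε > 0, ∀ᶠ h in 𝓝[>] (0 : ℝ),
      minMaxEig (fun u v => a h u v) (fun u v => b h u v) (k + q) ≤ lam + h * (mu q + ε) := by
    intro ε hε
    have key := eventually_le_of_perturbation (fun h => -a h) b (-a') b'
      (by simpa using has) hbs M hM hbM hb'M (-lam) (-mu q)
      (by
        intro u v
        have : (-a') u v - -lam * b' u v = -(a' u v - lam * b' u v) := by
          simp only [LinearMap.neg_apply]; ring
        rw [this, abs_neg]
        exact hEM u v)
      (by
        intro ρ hρ
        filter_upwards [hader ρ hρ] with h hh u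
        have : (-a h) u u - (-a 0) u u - h * (-a') u u = -(a h u u - a 0 u u - h * a' u u) := by
          simp only [LinearMap.neg_apply]; ring
        rw [this, abs_neg]
        exact hh u)
      hbder g c ε hg hc hε
    filter_upwards [key] with h hh
    have hq : (q : ℕ) + 1 ≤ m := q.2
    refine minMaxEig_le (ha0 h) (hb h) (by omega) (W ⊔ initialSpan psi (q + 1) hq)
      (by rw [hdim]; omega) _ fun v hv => ?_
    obtain ⟨w, hw, y, hy, rfl⟩ := Submodule.mem_sup.1 hv
    have hyY := initialSpan_le hmem _ hq hy
    have h1 := hh y w (fun v => by simpa using hY y hyY v) (hYW y hyY w hw) (hcY y hyY)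
      (by simp only [LinearMap.neg_apply]; linarith [hgW w hw]) (by
        have h2 : a' y y - lam * b' y y ≤ mu q * b 0 y y := by
          rw [(hEself y hyY).1, (hEself y hyY).2, Finset.mul_sum]
          refine Finset.sum_le_sum fun i _ => ?_
          rcases le_or_gt i q with hi | hi
          · exact mul_le_mul_of_nonneg_right (hmu hi) (sq_nonneg _)
          · rw [form_eq_zero_of_mem_initialSpan horth hy i (by
              have : (q : ℕ) < i := hi
              omega)]
            simp
        simp only [LinearMap.neg_apply]
        linarith)
    rw [add_comm w y]
    simp only [LinearMap.neg_apply] at h1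
    linarith
  obtain ⟨lam', hl1, hl2⟩ := exists_between hhigh
  have hl' : 0 < lam' := hlam.trans_lt hl1
  have hbnn : ∀ v, 0 ≤ b 0 v v := by
    intro v
    rcases eq_or_ne v 0 with rfl | h
    · simp
    · exact (hb 0 v h).le
  have lower : ∀ ε > 0, ∀ᶠ h in 𝓝[>] (0 : ℝ),
      lam + h * (mu q - ε) ≤ minMaxEig (fun u v => a h u v) (fun u v => b h u v) (k + q) := by
    intro ε hε
    have hg' : 0 < (1 - lam / lam') * δ := mul_pos (sub_pos.2 ((div_lt_one hl').2 hl1)) hδ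
    filter_upwards [eventually_le_of_perturbation a b a' b' has hbs M hM hbM hb'M lam (mu q)
      hEM hader hbder _ c ε hg' hc hε] with h hh
    refine le_minMaxEig (hab h) (hbb h) (hb h) (by omega) (hex _ (by omega)) _ fun L hL => ?_
    obtain ⟨u, huL, hu0, hu⟩ := exists_orthogonal_of_finrank_lt (a 0 - lam' • b 0)
      (W ⊔ initialSpan psi q q.2.le) L (by rw [hdim, hL]; omega)
    refine ⟨u, huL, hu0, ?_⟩
    simp only [LinearMap.sub_apply, LinearMap.smul_apply, smul_eq_mul] at hu
    obtain ⟨y, hy⟩ : ∃ y, y = ∑ i, b 0 (psi i) u • psi i := ⟨_, rfl⟩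
    have hyY : y ∈ Y := hy ▸ Y.sum_mem fun i _ => Y.smul_mem _ (hmem i)
    have hpy : ∀ i, b 0 (psi i) y = b 0 (psi i) u := fun i => by simp [hy, map_sum, horth]
    have hlowcoef : ∀ i < q, b 0 (psi i) u = 0 := by
      intro i hi
      have h1 := hu (psi i) (Submodule.mem_sup_right (mem_initialSpan i hi))
      rw [hY _ (hmem i), ← sub_mul] at h1
      exact (mul_eq_zero.1 h1).resolve_left (by linarith)
    have hYz : ∀ y' ∈ Y, b 0 y' (u - y) = 0 := by
      intro y' hy'
      rw [eq_sum_of_mem_of_orthonormal_form hm hYdim hmem horth hy']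
      simp [map_sum, hpy]
    have hz : lam' * b 0 (u - y) (u - y) ≤ a 0 (u - y) (u - y) := by
      refine le_of_orthogonal_of_lt_minMaxEig (ha0 0) (hb 0) has hbs
        (W ⊔ Y) lam' ?_ ?_ _ ?_
      · intro f hf
        obtain ⟨w, hw, x, hx, rfl⟩ := Submodule.mem_sup.1 hf
        have h1 := hgW w hw
        have h2 : 0 ≤ g * ‖w‖ ^ 2 := by positivity
        have h3 := hYW x hx w hw
        have h4 := mul_nonneg (sub_nonneg.2 hl1.le) (hbnn w)
        have h5 := mul_nonneg (sub_nonneg.2 hl1.le) (hbnn x)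
        simp only [map_add, LinearMap.add_apply, has w x, hbs w x, hY x hx, h3]
        linarith
      · rw [finrank_sup_of_form_orthogonal (hb 0) W Y hYW, hWdim, hYdim,
          show k - 1 + m + 1 = k + m by omega]
        exact hl2
      · intro f hf
        obtain ⟨w, hw, x, hx, rfl⟩ := Submodule.mem_sup.1 hf
        have h1 := hu w (Submodule.mem_sup_left hw)
        have h2 := hYW y hyY w hw
        have h3 := hYz x hx
        simp only [map_add, LinearMap.add_apply, hY x hx, h3]
        simp only [map_sub, has w y, hbs w y, hY y hyY, h2]
        linarith
    have h1 := hh y (u - y) (hY y hyY) (hYz y hyY) (hcY y hyY) (by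
        have h2 := mul_le_mul_of_nonneg_left (hac 0 (u - y))
          (sub_pos.2 ((div_lt_one hl').2 hl1)).le
        have h3 := mul_le_mul_of_nonneg_left hz (div_nonneg hlam hl'.le)
        rw [← mul_assoc, div_mul_cancel₀ _ hl'.ne'] at h3
        linarith) (by
        rw [(hEself y hyY).1, (hEself y hyY).2, Finset.mul_sum]
        refine Finset.sum_le_sum fun i _ => ?_
        rcases lt_or_ge i q with hi | hi
        · rw [hpy, hlowcoef i hi]
          simp
        · exact mul_le_mul_of_nonneg_right (hmu hi) (sq_nonneg _))
    rwa [add_sub_cancel] at h1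
  rw [Metric.tendsto_nhds]
  intro ε hε
  filter_upwards [upper (ε / 2) (by positivity), lower (ε / 2) (by positivity),
    self_mem_nhdsWithin] with h h1 h2 hpos
  have hpos : 0 < h := hpos
  rw [Real.dist_eq, abs_lt, lt_sub_iff_add_lt, lt_div_iff₀ hpos, sub_lt_iff_lt_add,
    div_lt_iff₀ hpos]
  constructor <;> nlinarith

theorem abs_apply_self_le_of_unit_ball (Q : V →ₗ[ℝ] V →ₗ[ℝ] ℝ) (r : ℝ)
    (h : ∀ u v, ‖u‖ ≤ 1 → ‖v‖ ≤ 1 → |Q u v| ≤ r) (u : V) : |Q u u| ≤ r * ‖u‖ ^ 2 := by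
  rcases eq_or_ne u 0 with rfl | h0
  · simp
  have hn : 0 < ‖u‖ := norm_pos_iff.2 h0
  have hu : ‖‖u‖⁻¹ • u‖ ≤ 1 := by simp [norm_smul, hn.ne']
  have h1 := h _ _ hu hu
  simp only [map_smul, LinearMap.smul_apply, smul_eq_mul, abs_mul, abs_inv, abs_norm] at h1
  have h2 := mul_le_mul_of_nonneg_right h1 (sq_nonneg ‖u‖)
  have h3 : ‖u‖⁻¹ * (‖u‖⁻¹ * |Q u u|) * ‖u‖ ^ 2 = |Q u u| := by field_simp
  rwa [h3] at h2

theorem eventually_taylor_of_unit_ball (a : ℝ → V →ₗ[ℝ] V →ₗ[ℝ] ℝ) (t : ℝ)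
    (a' : V →ₗ[ℝ] V →ₗ[ℝ] ℝ)
    (hder : ∀ ε > (0 : ℝ), ∃ η > (0 : ℝ), ∀ h : ℝ, h ≠ 0 → |h| < η →
      ∀ u v : V, ‖u‖ ≤ 1 → ‖v‖ ≤ 1 → |a (t + h) u v - a t u v - h * a' u v| ≤ ε * |h|)
    (ρ : ℝ) (hρ : 0 < ρ) :
    ∀ᶠ h in 𝓝[≠] (0 : ℝ), ∀ u,
      |a (t + h) u u - a t u u - h * a' u u| ≤ ρ * |h| * ‖u‖ ^ 2 := by
  obtain ⟨η, hη, hh⟩ := hder ρ hρ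
  rw [eventually_nhdsWithin_iff]
  filter_upwards [Metric.ball_mem_nhds (0 : ℝ) hη] with h hball hne u
  simpa using abs_apply_self_le_of_unit_ball (a (t + h) - a t - h • a') (ρ * |h|)
    (by simpa using hh h hne (by simpa using hball)) u

end MinMax

/-- existence and characterization of the one-sided first derivatives of a
multiple eigenvalue `λ = λ_k(t) = ⋯ = λ_{k+m−1}(t)`: for `j = k + q` (`q : Fin m`),
`λ̇_j⁺(t)` is the `(q+1)`-st eigenvalue `μ_q` of the pencil `(E, B_t)` on the eigenspace
`Y`, with `E = Ȧ_t − λḂ_t`, and `λ̇_j⁻(t) = μ_{m−1−q}`, i.e. `λ̇_j⁺ = λ̇_{2k+m−1−j}⁻`. -/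
theorem hadamard_stmt7
    {V : Type*} [NormedAddCommGroup V] [InnerProductSpace ℝ V] [CompleteSpace V]
    {X : Type*} [NormedAddCommGroup X] [InnerProductSpace ℝ X] [CompleteSpace X]
    (ι : V →L[ℝ] X) (hι : Function.Injective ι) (hcompact : IsCompactOperator ι)
    (A : ℝ → V →ₗ[ℝ] V →ₗ[ℝ] ℝ) (B : ℝ → X →ₗ[ℝ] X →ₗ[ℝ] ℝ)
    (hAsymm : ∀ t', ∀ u v : V, A t' u v = A t' v u)
    (hBsymm : ∀ t', ∀ u v : X, B t' u v = B t' v u)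
    (CA : ℝ) (hAbdd : ∀ t', ∀ u v : V, |A t' u v| ≤ CA * ‖u‖ * ‖v‖)
    (CB : ℝ) (hBbdd : ∀ t', ∀ u v : X, |B t' u v| ≤ CB * ‖u‖ * ‖v‖)
    (δ : ℝ) (hδ : 0 < δ)
    (hAcoer : ∀ t', ∀ v : V, δ * ‖v‖ ^ 2 ≤ A t' v v)
    (hBcoer : ∀ t', ∀ v : X, δ * ‖v‖ ^ 2 ≤ B t' v v)
    (lam : ℕ → ℝ → ℝ)
    (hlamdef : ∀ j t', lam j t' =
      minMaxEig (fun u v : V => A t' u v) (fun u v : V => B t' (ι u) (ι v)) j)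
    (t : ℝ)
    -- derivatives `Ȧ_t`, `Ḃ_t` : bounded bilinear forms with first-order Taylor property
    (A' : V →ₗ[ℝ] V →ₗ[ℝ] ℝ) (B' : X →ₗ[ℝ] X →ₗ[ℝ] ℝ)
    (CA' : ℝ) (hA'bdd : ∀ u v : V, |A' u v| ≤ CA' * ‖u‖ * ‖v‖)
    (CB' : ℝ) (hB'bdd : ∀ u v : X, |B' u v| ≤ CB' * ‖u‖ * ‖v‖)
    (hAder : ∀ ε > (0:ℝ), ∃ η > (0:ℝ), ∀ h : ℝ, h ≠ 0 → |h| < η →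
      ∀ u v : V, ‖u‖ ≤ 1 → ‖v‖ ≤ 1 →
        |A (t + h) u v - A t u v - h * A' u v| ≤ ε * |h|)
    (hBder : ∀ ε > (0:ℝ), ∃ η > (0:ℝ), ∀ h : ℝ, h ≠ 0 → |h| < η →
      ∀ u v : X, ‖u‖ ≤ 1 → ‖v‖ ≤ 1 →
        |B (t + h) u v - B t u v - h * B' u v| ≤ ε * |h|)
    (k m : ℕ) (hk : 1 ≤ k) (hm : 1 ≤ m)
    -- `λ` is an eigenvalue of multiplicity exactly `m` at `t`
    (lambda : ℝ) (hlambda : lambda = lam k t)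
    (hlow : 2 ≤ k → lam (k - 1) t < lam k t)
    (heqmult : ∀ j, k ≤ j → j ≤ k + m - 1 → lam j t = lambda)
    (hhigh : lam (k + m - 1) t < lam (k + m) t)
    -- `Y` is the eigenspace of `λ` at `t`, of dimension `m`
    (Y : Submodule ℝ V) (hYdim : Module.finrank ℝ Y = m)
    (hYeig : ∀ u : V, u ∈ Y ↔ ∀ v : V, A t u v = lambda * B t (ι u) (ι v))
    -- `μ_0 ≤ ⋯ ≤ μ_{m−1}` : the eigenvalues of the pencil `(E, B_t)` on `Y`,
    -- with `B_t`-orthonormal eigenvectors `ψ_q ∈ Y`, `E = Ȧ_t − λ Ḃ_t`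
    (mu : Fin m → ℝ) (hmumono : Monotone mu)
    (psi : Fin m → V) (hpsimem : ∀ q, psi q ∈ Y)
    (hpsiorth : ∀ q q' : Fin m, B t (ι (psi q)) (ι (psi q')) = if q = q' then 1 else 0)
    (hpsieig : ∀ q : Fin m, ∀ v ∈ Y,
      A' (psi q) v - lambda * B' (ι (psi q)) (ι v) = mu q * B t (ι (psi q)) (ι v)) :
    ∀ q : Fin m,
      Filter.Tendsto (fun h : ℝ => (lam (k + q) (t + h) - lam (k + q) t) / h)
        (nhdsWithin 0 (Set.Ioi 0)) (nhds (mu q)) ∧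
      Filter.Tendsto (fun h : ℝ => (lam (k + q) (t + h) - lam (k + q) t) / h)
        (nhdsWithin 0 (Set.Iio 0)) (nhds (mu q.rev)) := by
  let pull : (X →ₗ[ℝ] X →ₗ[ℝ] ℝ) → (V →ₗ[ℝ] V →ₗ[ℝ] ℝ) :=
    fun Q => Q.compl₁₂ (ι : V →ₗ[ℝ] X) (ι : V →ₗ[ℝ] X)
  have pull_apply : ∀ Q u v, pull Q u v = Q (ι u) (ι v) := fun _ _ _ => rfl
  have pull_bdd : ∀ (Q : X →ₗ[ℝ] X →ₗ[ℝ] ℝ) (C : ℝ), (∀ u v, |Q u v| ≤ C * ‖u‖ * ‖v‖) →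
      ∀ u v, |pull Q u v| ≤ |C| * ‖ι‖ ^ 2 * ‖u‖ * ‖v‖ := by
    intro Q C hQ u v
    calc |pull Q u v| ≤ C * ‖ι u‖ * ‖ι v‖ := hQ _ _
      _ ≤ |C| * (‖ι‖ * ‖u‖) * (‖ι‖ * ‖v‖) := by
        gcongr
        · exact le_abs_self C
        · exact ι.le_opNorm u
        · exact ι.le_opNorm v
      _ = |C| * ‖ι‖ ^ 2 * ‖u‖ * ‖v‖ := by ring
  have hBpos : ∀ s, ∀ v : V, v ≠ 0 → 0 < pull (B s) v v := by
    intro s v hv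
    have : 0 < ‖ι v‖ := norm_pos_iff.2 fun h => hv (hι (by rw [h, map_zero]))
    exact (by positivity : 0 < δ * ‖ι v‖ ^ 2).trans_le (hBcoer s (ι v))
  have hlam0 : 0 ≤ lambda := by
    rw [hlambda, hlamdef]
    exact minMaxEig_nonneg (b := pull (B t))
      (fun v => (by positivity : 0 ≤ δ * ‖v‖ ^ 2).trans (hAcoer t v)) (hBpos t) k
  have hAT := eventually_taylor_of_unit_ball A t A' hAder
  have hBT : ∀ ρ > 0, ∀ᶠ h in nhdsWithin (0 : ℝ) {0}ᶜ, ∀ u : V,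
      |pull (B (t + h)) u u - pull (B t) u u - h * pull B' u u| ≤ ρ * |h| * ‖u‖ ^ 2 := by
    intro ρ hρ
    have hpos : 0 < ‖ι‖ ^ 2 + 1 := by positivity
    filter_upwards [eventually_taylor_of_unit_ball B t B' hBder (ρ / (‖ι‖ ^ 2 + 1))
      (by positivity)] with h hh u
    have hsq : ‖ι u‖ ^ 2 ≤ (‖ι‖ ^ 2 + 1) * ‖u‖ ^ 2 := by
      have := pow_le_pow_left₀ (norm_nonneg _) (ι.le_opNorm u) 2
      nlinarith [sq_nonneg ‖u‖]
    calc |pull (B (t + h)) u u - pull (B t) u u - h * pull B' u u|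
        ≤ ρ / (‖ι‖ ^ 2 + 1) * |h| * ‖ι u‖ ^ 2 := hh (ι u)
      _ ≤ ρ / (‖ι‖ ^ 2 + 1) * |h| * ((‖ι‖ ^ 2 + 1) * ‖u‖ ^ 2) := by gcongr
      _ = ρ * |h| * ‖u‖ ^ 2 := by field_simp
  obtain ⟨M, hM, hM1, hM2, hM3⟩ : ∃ M : ℝ, 0 ≤ M ∧
      (∀ u v, |pull (B t) u v| ≤ M * ‖u‖ * ‖v‖) ∧ (∀ u v, |pull B' u v| ≤ M * ‖u‖ * ‖v‖) ∧
      ∀ u v, |A' u v - lambda * pull B' u v| ≤ M * ‖u‖ * ‖v‖ := by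
    have e1 := pull_bdd (B t) CB (hBbdd t)
    have e2 := pull_bdd B' CB' hB'bdd
    have mono : ∀ {x C D : ℝ} {u v : V}, x ≤ C * ‖u‖ * ‖v‖ → C ≤ D → x ≤ D * ‖u‖ * ‖v‖ :=
      fun h hCD => h.trans (by gcongr)
    have n1 : 0 ≤ |CB| * ‖ι‖ ^ 2 := by positivity
    have n2 : 0 ≤ |CB'| * ‖ι‖ ^ 2 := by positivity
    have n3 : 0 ≤ lambda * (|CB'| * ‖ι‖ ^ 2) := by positivity
    have n4 := abs_nonneg CA'
    refine ⟨|CB| * ‖ι‖ ^ 2 + |CB'| * ‖ι‖ ^ 2 + (|CA'| + lambda * (|CB'| * ‖ι‖ ^ 2)),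
      by positivity, fun u v => mono (e1 u v) (by linarith),
      fun u v => mono (e2 u v) (by linarith), fun u v => ?_⟩
    refine mono (C := |CA'| + lambda * (|CB'| * ‖ι‖ ^ 2)) ?_ (by linarith)
    refine (abs_sub _ _).trans ?_
    rw [abs_mul, abs_of_nonneg hlam0]
    have f1 := mono (hA'bdd u v) (le_abs_self CA')
    have f2 := mul_le_mul_of_nonneg_left (e2 u v) hlam0
    linarith
  have hlow' : 2 ≤ k → minMaxEig (fun u v => A t u v) (fun u v => pull (B t) u v) (k - 1)
      < lambda := by
    intro h
    have := hlow h
    rwa [← hlambda, hlamdef] at this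
  have hhigh' : lambda < minMaxEig (fun u v => A t u v) (fun u v => pull (B t) u v) (k + m) := by
    have := hhigh
    rwa [heqmult (k + m - 1) (by omega) le_rfl, hlamdef] at this
  intro q
  rw [heqmult (k + q) (by omega) (by have := q.2; omega)]
  simp only [hlamdef]
  constructor
  · refine tendsto_minMaxEig_right (fun h => A (t + h)) (fun h => pull (B (t + h))) A' (pull B')
      ?_ ?_ CA (|CB| * ‖ι‖ ^ 2) M δ hδ hM (fun h => hAbdd _) (fun h => pull_bdd _ CB (hBbdd _))
      (fun h => hAcoer _) (fun h => hBpos _) ?_ hM2 lambda hM3 ?_ ?_ k m hk hm ?_ hlam0 ?_ Y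
      hYdim ?_ mu hmumono psi hpsimem ?_ ?_ q
    · exact hAsymm _
    · exact fun u v => hBsymm _ _ _
    · simpa only [add_zero] using hM1
    · intro ρ hρ
      filter_upwards [(hAT ρ hρ).filter_mono (nhdsWithin_mono _ fun x (hx : 0 < x) => hx.ne'),
        self_mem_nhdsWithin] with h hh (hpos : 0 < h) u
      simpa only [add_zero, abs_of_pos hpos] using hh u
    · intro ρ hρ
      filter_upwards [(hBT ρ hρ).filter_mono (nhdsWithin_mono _ fun x (hx : 0 < x) => hx.ne'),
        self_mem_nhdsWithin] with h hh (hpos : 0 < h) u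
      simpa only [add_zero, abs_of_pos hpos] using hh u
    · simpa only [add_zero] using hlow'
    · simpa only [add_zero] using hhigh'
    · simp only [add_zero]
      exact fun y hy => (hYeig y).1 hy
    · simp only [add_zero]
      exact hpsiorth
    · simp only [add_zero]
      exact hpsieig
  · have hnegNE : Filter.Tendsto (fun h : ℝ => -h) (nhdsWithin 0 (Set.Ioi 0))
        (nhdsWithin 0 {0}ᶜ) := by
      have : Filter.Tendsto (fun h : ℝ => -h) (nhdsWithin 0 (Set.Ioi 0))
          (nhdsWithin 0 (Set.Iio 0)) := by
        simpa using tendsto_neg_nhdsGT (a := (0 : ℝ))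
      exact this.mono_right (nhdsWithin_mono _ fun x (hx : x < 0) => hx.ne)
    have main := tendsto_minMaxEig_right (fun h => A (t + -h)) (fun h => pull (B (t + -h))) (-A')
      (-pull B') (hAsymm _) (fun u v => hBsymm _ _ _) CA (|CB| * ‖ι‖ ^ 2) M δ hδ hM
      (fun h => hAbdd _) (fun h => pull_bdd _ CB (hBbdd _)) (fun h => hAcoer _)
      (fun h => hBpos _) (by simpa only [neg_zero, add_zero] using hM1)
      (by simpa only [LinearMap.neg_apply, abs_neg] using hM2) lambda
      (by
        intro u v
        have : (-A') u v - lambda * (-pull B') u v = -(A' u v - lambda * pull B' u v) := by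
          simp only [LinearMap.neg_apply]; ring
        rw [this, abs_neg]
        exact hM3 u v)
      (by
        intro ρ hρ
        filter_upwards [hnegNE.eventually (hAT ρ hρ),
          self_mem_nhdsWithin] with h hh (hpos : 0 < h) u
        have := hh u
        rw [abs_neg, abs_of_pos hpos] at this
        simpa only [neg_zero, add_zero, LinearMap.neg_apply, mul_neg, neg_mul] using this)
      (by
        intro ρ hρ
        filter_upwards [hnegNE.eventually (hBT ρ hρ),
          self_mem_nhdsWithin] with h hh (hpos : 0 < h) u
        have := hh u
        rw [abs_neg, abs_of_pos hpos] at this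
        simpa only [neg_zero, add_zero, LinearMap.neg_apply, mul_neg, neg_mul] using this)
      k m hk hm (by simpa only [neg_zero, add_zero] using hlow') hlam0
      (by simpa only [neg_zero, add_zero] using hhigh') Y hYdim
      (by
        simp only [neg_zero, add_zero]
        exact fun y hy => (hYeig y).1 hy)
      (fun i => -mu i.rev) (fun i j hij => neg_le_neg (hmumono (Fin.rev_le_rev.2 hij)))
      (fun i => psi i.rev) (fun i => hpsimem _)
      (by
        simp only [neg_zero, add_zero]
        intro i j
        simpa only [Fin.rev_inj, pull_apply] using hpsiorth i.rev j.rev)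
      (by
        simp only [neg_zero, add_zero, LinearMap.neg_apply]
        intro i v hv
        have := hpsieig i.rev v hv
        simp only [pull_apply]
        linarith)
      q
    have hneg : Filter.Tendsto (fun h : ℝ => -h) (nhdsWithin 0 (Set.Iio 0))
        (nhdsWithin 0 (Set.Ioi 0)) := by
      simpa using tendsto_neg_nhdsLT (a := (0 : ℝ))
    have hlim := (main.comp hneg).neg
    rw [neg_neg] at hlim
    refine hlim.congr fun h => ?_
    simp only [Function.comp_apply, neg_neg, div_neg]
    rfl
end

section
/- Let f_1 ≤ ⋯ ≤ f_m be continuous functions on an interval I possessing unilaterally continuous one-sided derivatives satisfying the cluster crossing relation ḟ_j^+(t) = ḟ_{2k+n−j−1}^−(t) on every cluster. Then there exist C¹ functions g_1, …, g_m on I obtained from the f_j by rearrangement (i.e., for every t, the multiset {g_1(t),…,g_m(t)} equals {f_1(t),…,f_m(t)}). -/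
/-- `IsCluster f m k n t` : `f_{k−1}(t) < f_k(t) = ⋯ = f_{k+n−1}(t) < f_{k+n}(t)`
(conventions `f_0 = −∞`, `f_{m+1} = +∞`). -/
def IsCluster (f : ℕ → ℝ → ℝ) (m k n : ℕ) (t : ℝ) : Prop :=
  1 ≤ k ∧ 1 ≤ n ∧ k + n - 1 ≤ m ∧
  (2 ≤ k → f (k - 1) t < f k t) ∧
  (∀ j, k ≤ j → j ≤ k + n - 1 → f j t = f k t) ∧
  (k + n ≤ m → f (k + n - 1) t < f (k + n) t)

open Filter Topology Set

/-- In a finite group, a family `R` indexed by a linear order has an "ordered product" `σ`: right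
after `t` it is multiplied by `R t`, up to the factors `R u` with `u` strictly between. -/
theorem exists_ordered_product {α G : Type*} [LinearOrder α] [Group G] [Finite G] (R : α → G) :
    ∃ σ : α → G, ∀ t s, t < s →
      σ s * (R t * σ t)⁻¹ ∈ Subgroup.closure (R '' Ioo t s) := by
  have hfin : ∀ F : Finset α, ∃ σ : α → G, ∀ t ∈ F, ∀ s, t < s →
      σ s * (R t * σ t)⁻¹ ∈ Subgroup.closure (R '' Ioo t s) := by
    intro F
    induction F using Finset.induction_on_max with
    | empty => exact ⟨fun _ => 1, by simp⟩
    | insert a F ha ih =>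
      obtain ⟨σ, hσ⟩ := ih
      refine ⟨fun s => if s ≤ a then σ s else R a * σ a, fun t ht s hts => ?_⟩
      rcases Finset.mem_insert.1 ht with rfl | ht
      · simp [not_le.2 hts, one_mem]
      · have hta := ha t ht
        by_cases hsa : s ≤ a
        · simpa [hsa, hta.le] using hσ t ht s hts
        · push Not at hsa
          simp only [not_le.2 hsa, hta.le, if_true, if_false]
          rw [mul_assoc]
          refine mul_mem (Subgroup.subset_closure ⟨a, ⟨hta, hsa⟩, rfl⟩) ?_
          exact Subgroup.closure_mono (image_mono (Ioo_subset_Ioo_right hsa.le)) (hσ t ht a hta)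
  choose σ hσ using hfin
  let U : Ultrafilter (Finset α) := Ultrafilter.of atTop
  have hlim : ∀ s, ∃ x : G, ∀ᶠ F in (U : Filter (Finset α)), σ F s = x := by
    intro s
    obtain ⟨x, hx⟩ := Ultrafilter.eq_pure_of_finite (U.map fun F => σ F s)
    refine ⟨x, ?_⟩
    have : ({x} : Set G) ∈ U.map fun F => σ F s := by rw [hx]; exact rfl
    exact this
  choose τ hτ using hlim
  refine ⟨τ, fun t s hts => ?_⟩
  have ht : ∀ᶠ F in (U : Filter (Finset α)), {t} ⊆ F :=
    (eventually_ge_atTop {t}).filter_mono (Ultrafilter.of_le atTop)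
  obtain ⟨F, h₁, h₂, h₃⟩ := (ht.and ((hτ t).and (hτ s))).exists
  rw [← h₂, ← h₃]
  exact hσ F t (by simpa using h₁) s hts

theorem apply_eq_of_mem_closure {ι X : Type*} (φ : ι → X) {S : Set (Equiv.Perm ι)}
    (hS : ∀ c ∈ S, ∀ i, φ (c i) = φ i) {π : Equiv.Perm ι} (hπ : π ∈ Subgroup.closure S) (i : ι) :
    φ (π i) = φ i := by
  induction hπ using Subgroup.closure_induction generalizing i with
  | mem c hc => exact hS c hc i
  | one => rfl
  | mul a b _ _ ha hb => rw [Equiv.Perm.mul_apply, ha, hb]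
  | inv a _ ha => simpa using (ha (a⁻¹ i)).symm

theorem tendsto_of_finite_selection {α ι X : Type*} [Finite ι] [TopologicalSpace X] {l : Filter α}
    {F : ι → α → X} {a : ι → X} (hF : ∀ j, Tendsto (F j) l (𝓝 (a j))) {τ : α → ι} {b : X}
    (hτ : ∀ᶠ s in l, a (τ s) = b) : Tendsto (fun s => F (τ s) s) l (𝓝 b) := by
  refine tendsto_def.2 fun V hV => ?_
  have h : ∀ᶠ s in l, ∀ j, a j = b → F j s ∈ V := by
    refine eventually_all.2 fun j => ?_
    by_cases hj : a j = b
    · filter_upwards [hF j (hj ▸ hV)] with s hs _ using hs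
    · exact Eventually.of_forall fun s h => absurd h hj
  filter_upwards [h, hτ] with s hs hb using hs _ hb

theorem eventually_eq_imp_jet_eq {ι : Type*} [Finite ι] {f : ι → ℝ → ℝ} {d : ι → ℝ} {S : Set ℝ}
    {t : ℝ} (ht : t ∉ S) (hf : ∀ j, HasDerivWithinAt (f j) (d j) S t) :
    ∀ᶠ s in 𝓝[S] t, ∀ i j, f i s = f j s → (f i t, d i) = (f j t, d j) := by
  refine eventually_all.2 fun i => eventually_all.2 fun j => ?_
  have hg := (hf i).sub (hf j)
  by_cases h0 : f i t = f j t
  · by_cases h1 : d i = d j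
    · simp [h0, h1]
    · have := hg.eventually_ne (c := 0) (sub_ne_zero.2 h1)
      rw [sdiff_singleton_eq_self ht] at this
      filter_upwards [this] with s hs h
      exact absurd (sub_eq_zero.2 h) hs
  · have := hg.continuousWithinAt.eventually_ne (sub_ne_zero.2 h0)
    filter_upwards [this] with s hs h
    exact absurd (sub_eq_zero.2 h) hs

theorem hasDerivWithinAt_of_finite_selection {ι : Type*} [Finite ι] {f : ι → ℝ → ℝ} {d : ι → ℝ}
    {S : Set ℝ} {t : ℝ} (ht : t ∉ S) (hf : ∀ j, HasDerivWithinAt (f j) (d j) S t) {τ : ℝ → ι}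
    {b : ℝ} (hτ : ∀ᶠ s in 𝓝[S] t, f (τ s) t = f (τ t) t ∧ d (τ s) = b) :
    HasDerivWithinAt (fun s => f (τ s) s) b S t := by
  rw [hasDerivWithinAt_iff_tendsto_slope' ht]
  have := tendsto_of_finite_selection
    (fun j => (hasDerivWithinAt_iff_tendsto_slope' ht).1 (hf j)) (hτ.mono fun _ h => h.2)
  refine this.congr' ?_
  filter_upwards [hτ] with s hs
  simp only [slope_def_field, hs.1]

/-- A finite family of curves with unilaterally continuous one-sided derivatives, for which the
left and right `1`-jets at every point agree up to a permutation, has a `C¹` rearrangement. -/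
theorem exists_C1_rearrangement {ι : Type*} [Finite ι] {f dp dm : ι → ℝ → ℝ}
    (hdp : ∀ j t, HasDerivWithinAt (f j) (dp j t) (Ioi t) t)
    (hdm : ∀ j t, HasDerivWithinAt (f j) (dm j t) (Iio t) t)
    (hdpcont : ∀ j t, Tendsto (dp j) (𝓝[>] t) (𝓝 (dp j t)))
    (hdmcont : ∀ j t, Tendsto (dm j) (𝓝[<] t) (𝓝 (dm j t)))
    (R : ℝ → Equiv.Perm ι) (hRf : ∀ t j, f (R t j) t = f j t)
    (hRd : ∀ t j, dp (R t j) t = dm j t) :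
    ∃ σ : ℝ → Equiv.Perm ι, ∀ i, (∀ t, HasDerivAt (fun s => f (σ s i) s) (dm (σ t i) t) t) ∧
      Continuous fun t => dm (σ t i) t := by
  obtain ⟨σ, hσ⟩ := exists_ordered_product R
  have hleftR : ∀ t, ∀ᶠ s in 𝓝[<] t, ∀ j, (f (R s j) t, dm (R s j) t) = (f j t, dm j t) := by
    intro t
    filter_upwards [eventually_eq_imp_jet_eq (S := Iio t) (by simp) (hdm · t)] with s hs j
    exact hs _ _ (hRf s j)
  have hrightR : ∀ t, ∀ᶠ s in 𝓝[>] t, ∀ j, (f (R s j) t, dp (R s j) t) = (f j t, dp j t) := by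
    intro t
    filter_upwards [eventually_eq_imp_jet_eq (S := Ioi t) (by simp) (hdp · t)] with s hs j
    exact hs _ _ (hRf s j)
  have hleft : ∀ t, ∀ᶠ s in 𝓝[<] t, ∀ i,
      f (σ s i) t = f (σ t i) t ∧ dm (σ s i) t = dm (σ t i) t := by
    intro t
    obtain ⟨a, ha, hsub⟩ := mem_nhdsLT_iff_exists_Ioo_subset.1 (hleftR t)
    filter_upwards [Ioo_mem_nhdsLT ha] with s hs i
    have h := apply_eq_of_mem_closure (fun j => (f j t, dm j t)) (by
      rintro _ ⟨u, hu, rfl⟩ j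
      exact hsub ⟨hs.1.trans hu.1, hu.2⟩ j) (hσ s t hs.2) (R s (σ s i))
    have h' := (hsub hs (σ s i)).symm.trans h.symm
    simpa [mul_inv_rev, Equiv.Perm.mul_apply] using h'
  have hright : ∀ t, ∀ᶠ s in 𝓝[>] t, ∀ i,
      f (σ s i) t = f (σ t i) t ∧ dp (σ s i) t = dm (σ t i) t := by
    intro t
    obtain ⟨b, hb, hsub⟩ := mem_nhdsGT_iff_exists_Ioo_subset.1 (hrightR t)
    filter_upwards [Ioo_mem_nhdsGT hb] with s hs i
    have h := apply_eq_of_mem_closure (fun j => (f j t, dp j t)) (by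
      rintro _ ⟨u, hu, rfl⟩ j
      exact hsub ⟨hu.1, hu.2.trans hs.2⟩ j) (hσ t s hs.1) (R t (σ t i))
    simpa [mul_inv_rev, Equiv.Perm.mul_apply, hRf, hRd] using h
  refine ⟨σ, fun i => ⟨fun t => ?_, continuous_iff_continuousAt.2 fun t => ?_⟩⟩
  · have hl := hasDerivWithinAt_of_finite_selection (S := Iio t) (by simp) (hdm · t)
      ((hleft t).mono fun s hs => hs i)
    have hr := hasDerivWithinAt_of_finite_selection (S := Ioi t) (by simp) (hdp · t)
      ((hright t).mono fun s hs => hs i)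
    rw [hasDerivAt_iff_tendsto_slope, ← Iio_union_Ioi, nhdsWithin_union]
    exact ((hasDerivWithinAt_iff_tendsto_slope' (by simp)).1 hl).sup
      ((hasDerivWithinAt_iff_tendsto_slope' (by simp)).1 hr)
  · rw [continuousAt_iff_punctured_nhds, ← Iio_union_Ioi, nhdsWithin_union]
    refine Tendsto.sup ?_ ?_
    · exact tendsto_of_finite_selection (hdmcont · t) ((hleft t).mono fun s hs => (hs i).2)
    · have h := tendsto_of_finite_selection (τ := fun s => R s (σ s i)) (hdpcont · t)
        (b := dm (σ t i) t) (by
          filter_upwards [hright t, hrightR t] with s h₁ h₂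
          exact (Prod.mk.inj (h₂ (σ s i))).2.trans (h₁ i).2)
      simpa only [hRd] using h

/-- Every index of an ordered family belongs to a cluster. -/
theorem exists_isCluster {f : ℕ → ℝ → ℝ} {m : ℕ} {t : ℝ}
    (horder : ∀ j, 1 ≤ j → j + 1 ≤ m → f j t ≤ f (j + 1) t) {j : ℕ} (hj : 1 ≤ j) (hjm : j ≤ m) :
    ∃ k n, IsCluster f m k n t ∧ k ≤ j ∧ j ≤ k + n - 1 := by
  have hmono : ∀ a b, 1 ≤ a → a ≤ b → b ≤ m → f a t ≤ f b t := by
    intro a b ha hab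
    induction b, hab using Nat.le_induction with
    | base => exact fun _ => le_rfl
    | succ b hab ih => exact fun hb => (ih (by omega)).trans (horder b (by omega) hb)
  let C := (Finset.Icc 1 m).filter fun i => f i t = f j t
  have hjC : j ∈ C := by simp [C, hj, hjm]
  have hC : ∀ i, i ∈ C ↔ (1 ≤ i ∧ i ≤ m) ∧ f i t = f j t := by simp [C]
  obtain ⟨k, hk, hkmin⟩ := C.exists_min_image id ⟨j, hjC⟩
  obtain ⟨l, hl, hlmax⟩ := C.exists_max_image id ⟨j, hjC⟩
  simp only [id] at hkmin hlmax
  have hkj := hkmin j hjC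
  have hjl := hlmax j hjC
  rw [hC] at hk hl
  refine ⟨k, l - k + 1, ⟨hk.1.1, by omega, by omega, fun h2 => ?_, fun i hi hi' => ?_,
    fun hlm => ?_⟩, hkj, by omega⟩
  · refine lt_of_le_of_ne (hmono _ _ (by omega) (by omega) hk.1.2) fun h => ?_
    have := hkmin (k - 1) ((hC _).2 ⟨⟨by omega, by omega⟩, h.trans hk.2⟩)
    omega
  · refine le_antisymm ?_ (hmono _ _ hk.1.1 hi (by omega))
    rw [hk.2, ← hl.2]
    exact hmono _ _ (by omega) (by omega) hl.1.2
  · have e : k + (l - k + 1) - 1 = l := by omega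
    have e' : k + (l - k + 1) = l + 1 := by omega
    rw [e, e']
    refine lt_of_le_of_ne (hmono _ _ hl.1.1 (by omega) (by omega)) fun h => ?_
    have := hlmax (l + 1) ((hC _).2 ⟨⟨by omega, by omega⟩, h.symm.trans hl.2⟩)
    omega

theorem IsCluster.eq_of_eq {f : ℕ → ℝ → ℝ} {m k n k' n' : ℕ} {t : ℝ}
    (h : IsCluster f m k n t) (h' : IsCluster f m k' n' t) {i : ℕ}
    (hi : k ≤ i ∧ i ≤ k + n - 1) (hi' : k' ≤ i ∧ i ≤ k' + n' - 1) : k = k' ∧ n = n' := by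
  obtain ⟨a1, a2, a3, a4, a5, a6⟩ := h
  obtain ⟨b1, b2, b3, b4, b5, b6⟩ := h'
  have hk : k = k' := by
    rcases lt_trichotomy k k' with hlt | heq | hlt
    · exact absurd ((a5 (k' - 1) (by omega) (by omega)).trans (a5 k' (by omega) (by omega)).symm)
        (b4 (by omega)).ne
    · exact heq
    · exact absurd ((b5 (k - 1) (by omega) (by omega)).trans (b5 k (by omega) (by omega)).symm)
        (a4 (by omega)).ne
  subst hk
  refine ⟨rfl, ?_⟩
  rcases lt_trichotomy n n' with hlt | heq | hlt
  · exact absurd ((b5 (k + n - 1) (by omega) (by omega)).trans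
      (b5 (k + n) (by omega) (by omega)).symm) (a6 (by omega)).ne
  · exact heq
  · exact absurd ((a5 (k + n' - 1) (by omega) (by omega)).trans
      (a5 (k + n') (by omega) (by omega)).symm) (b6 (by omega)).ne

/-- The permutation reversing every cluster at `t`. -/
theorem exists_cluster_reversal {f : ℕ → ℝ → ℝ} {m : ℕ} {t : ℝ}
    (horder : ∀ j, 1 ≤ j → j + 1 ≤ m → f j t ≤ f (j + 1) t) :
    ∃ R : Equiv.Perm (Finset.Icc 1 m), ∀ j : Finset.Icc 1 m, ∃ k n, IsCluster f m k n t ∧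
      k ≤ (j : ℕ) ∧ (j : ℕ) ≤ k + n - 1 ∧ (R j : ℕ) = 2 * k + n - j - 1 := by
  have h : ∀ j : Finset.Icc 1 m, ∃ i : Finset.Icc 1 m, ∃ k n, IsCluster f m k n t ∧
      k ≤ (j : ℕ) ∧ (j : ℕ) ≤ k + n - 1 ∧ (i : ℕ) = 2 * k + n - j - 1 := by
    rintro ⟨j, hj⟩
    rw [Finset.mem_Icc] at hj
    obtain ⟨k, n, hc, h₁, h₂⟩ := exists_isCluster horder hj.1 hj.2
    have hc' := hc
    obtain ⟨a1, a2, a3, -⟩ := hc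
    exact ⟨⟨2 * k + n - j - 1, Finset.mem_Icc.2 ⟨by omega, by omega⟩⟩, k, n, hc', h₁, h₂, rfl⟩
  choose r k n hc h₁ h₂ hr using h
  have hinv : Function.Involutive r := by
    intro j
    obtain ⟨hk, hn⟩ := (hc j).eq_of_eq (hc (r j)) (i := r j)
      (by have := h₁ j; have := h₂ j; have := hr j; omega) ⟨h₁ _, h₂ _⟩
    refine Subtype.ext ?_
    have := h₁ j; have := h₂ j; have := hr j; have := hr (r j)
    omega
  exact ⟨hinv.toPerm, fun j => ⟨k j, n j, hc j, h₁ j, h₂ j, hr j⟩⟩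

theorem tendsto_add_left_zero_nhdsGT_iff {X : Type*} {F : ℝ → X} {t : ℝ} {l : Filter X} :
    Tendsto (fun h => F (t + h)) (𝓝[>] 0) l ↔ Tendsto F (𝓝[>] t) l := by
  have : map (t + ·) (𝓝[>] (0 : ℝ)) = 𝓝[>] t := by
    simp
  rw [← this, tendsto_map'_iff]
  rfl

theorem tendsto_add_left_zero_nhdsLT_iff {X : Type*} {F : ℝ → X} {t : ℝ} {l : Filter X} :
    Tendsto (fun h => F (t + h)) (𝓝[<] 0) l ↔ Tendsto F (𝓝[<] t) l := by
  have : map (t + ·) (𝓝[<] (0 : ℝ)) = 𝓝[<] t := by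
    simp
  rw [← this, tendsto_map'_iff]
  rfl

/-- Rellich's C¹ rearrangement theorem, abstract form: continuous
ordered curves `f_1 ≤ ⋯ ≤ f_m` with unilaterally continuous one-sided derivatives
satisfying the crossing relation on every cluster can be rearranged (same multiset of
values at every `t`) into `C¹` functions `g_1, …, g_m`. -/
theorem hadamard_stmt11
    (m : ℕ) (hm : 1 ≤ m) (f : ℕ → ℝ → ℝ)
    (hcont : ∀ j, 1 ≤ j → j ≤ m → Continuous (f j))
    (horder : ∀ t, ∀ j, 1 ≤ j → j + 1 ≤ m → f j t ≤ f (j + 1) t)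
    (dp dm : ℕ → ℝ → ℝ)
    (hdp : ∀ j t, 1 ≤ j → j ≤ m →
      Filter.Tendsto (fun h : ℝ => (f j (t + h) - f j t) / h)
        (nhdsWithin 0 (Set.Ioi 0)) (nhds (dp j t)))
    (hdm : ∀ j t, 1 ≤ j → j ≤ m →
      Filter.Tendsto (fun h : ℝ => (f j (t + h) - f j t) / h)
        (nhdsWithin 0 (Set.Iio 0)) (nhds (dm j t)))
    (hdpcont : ∀ j t, 1 ≤ j → j ≤ m →
      Filter.Tendsto (fun h : ℝ => dp j (t + h)) (nhdsWithin 0 (Set.Ioi 0))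
        (nhds (dp j t)))
    (hdmcont : ∀ j t, 1 ≤ j → j ≤ m →
      Filter.Tendsto (fun h : ℝ => dm j (t + h)) (nhdsWithin 0 (Set.Iio 0))
        (nhds (dm j t)))
    (hcross : ∀ t k n, IsCluster f m k n t →
      ∀ j, k ≤ j → j ≤ k + n - 1 → dp j t = dm (2 * k + n - j - 1) t) :
    ∃ g g' : ℕ → ℝ → ℝ,
      (∀ j, 1 ≤ j → j ≤ m →
        (∀ t, HasDerivAt (g j) (g' j t) t) ∧ Continuous (g' j)) ∧
      (∀ t : ℝ,
        Multiset.map (fun j => g j t) (Finset.Icc 1 m).val =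
        Multiset.map (fun j => f j t) (Finset.Icc 1 m).val) := by
  choose R hR using fun t => exists_cluster_reversal (horder t)
  have hmem (j : Finset.Icc 1 m) : 1 ≤ (j : ℕ) ∧ (j : ℕ) ≤ m := Finset.mem_Icc.1 j.2
  obtain ⟨σ, hσ⟩ := exists_C1_rearrangement (ι := Finset.Icc 1 m)
    (f := fun j => f j) (dp := fun j => dp j) (dm := fun j => dm j)
    (fun j t => by
      rw [hasDerivWithinAt_iff_tendsto_slope' (by simp), ← tendsto_add_left_zero_nhdsGT_iff]
      simpa [slope_def_field] using hdp j t (hmem j).1 (hmem j).2)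
    (fun j t => by
      rw [hasDerivWithinAt_iff_tendsto_slope' (by simp), ← tendsto_add_left_zero_nhdsLT_iff]
      simpa [slope_def_field] using hdm j t (hmem j).1 (hmem j).2)
    (fun j t => tendsto_add_left_zero_nhdsGT_iff.1 (hdpcont j t (hmem j).1 (hmem j).2))
    (fun j t => tendsto_add_left_zero_nhdsLT_iff.1 (hdmcont j t (hmem j).1 (hmem j).2))
    R
    (fun t j => by
      obtain ⟨k, n, hc, h₁, h₂, hr⟩ := hR t j
      have hconst := hc.2.2.2.2.1
      exact (hconst _ (by omega) (by omega)).trans (hconst _ h₁ h₂).symm)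
    (fun t j => by
      obtain ⟨k, n, hc, h₁, h₂, hr⟩ := hR t j
      have h := hcross t k n hc (R t j) (by omega) (by omega)
      rwa [show 2 * k + n - (R t j : ℕ) - 1 = j by omega] at h)
  refine ⟨fun j t => if hj : j ∈ Finset.Icc 1 m then f (σ t ⟨j, hj⟩) t else 0,
    fun j t => if hj : j ∈ Finset.Icc 1 m then dm (σ t ⟨j, hj⟩) t else 0,
    fun j h₁ h₂ => ?_, fun t => ?_⟩
  · have hj : j ∈ Finset.Icc 1 m := Finset.mem_Icc.2 ⟨h₁, h₂⟩
    simpa only [hj, dif_pos] using hσ ⟨j, hj⟩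
  · have hval : (Finset.Icc 1 m).val =
        (Finset.univ : Finset (Finset.Icc 1 m)).val.map Subtype.val :=
      (Multiset.attach_map_val _).symm
    rw [hval, Multiset.map_map, Multiset.map_map]
    have hperm := congrArg Finset.val (Finset.map_univ_equiv (σ t))
    rw [Finset.map_val] at hperm
    conv_rhs => rw [← hperm, Multiset.map_map]
    exact Multiset.map_congr rfl fun j _ => dif_pos j.2
end
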